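/- (Lemma 4.2) Suppose W = (W₁,…,W_n) consists of independent random variables, all supported on the interval [a, b]. Then for every q ∈ [1,∞] and every t ≥ 0, P{ ‖(1/n)XᵀW‖_q ≥ E[‖(1/n)XᵀW‖_q] + t } ≤ exp( −n t² / (2 (b − a)² N_q(X)²) ). -/

import Mathlib

open MeasureTheory ProbabilityTheory
open scoped ENNReal NNReal

noncomputable def lqNorm (q : ℝ≥0∞) {L : ℕ} (v : Fin L → ℝ) : ℝ :=
  (eLpNorm v q Measure.count).toReal

noncomputable def Nq (q : ℝ≥0∞) {n L : ℕ} (X : Fin n → Fin L → ℝ) : ℝ :=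
  lqNorm q (fun j => Real.sqrt ((1 / (n : ℝ)) * ∑ i, (X i j) ^ 2))

noncomputable def gaussianVec (n : ℕ) (σ : ℝ) : Measure (Fin n → ℝ) :=
  Measure.pi (fun _ => gaussianReal 0 ⟨σ ^ 2, sq_nonneg σ⟩)

lemma aux_exp (u : ℝ) (hu : 0 ≤ u) :
    ∃ θ : ℝ, 0 ≤ θ ∧ θ ≤ 1 ∧ Real.exp ((1 - θ) * u + θ ^ 2 / 2) ≤ 1 + u := by
  rcases le_total u 1 with h | h
  · refine ⟨u, hu, h, ?_⟩
    rw [← Real.le_log_iff_exp_le (by linarith)]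
    refine le_trans ?_ (Real.le_log_one_add_of_nonneg hu)
    rw [le_div_iff₀ (by linarith)]
    nlinarith [pow_nonneg hu 3]
  · refine ⟨1, by norm_num, le_rfl, ?_⟩
    rw [← Real.le_log_iff_exp_le (by linarith)]
    refine le_trans ?_ (Real.le_log_one_add_of_nonneg hu)
    rw [le_div_iff₀ (by linarith)]
    nlinarith

lemma aux_integrable {n : ℕ} (a b : ℝ) (μ : Fin n → Measure ℝ) [∀ i, IsProbabilityMeasure (μ i)]
    (hsupp : ∀ i, μ i (Set.Icc a b) = 1) (f : (Fin n → ℝ) → ℝ) (hf : Continuous f) :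
    Integrable f (Measure.pi μ) := by
  have h1 : Measure.pi μ (Set.Icc (fun _ => a) (fun _ => b)) = 1 := by
    rw [← Set.pi_univ_Icc, Measure.pi_pi]
    simp [hsupp]
  have h2 : ∀ᵐ x ∂(Measure.pi μ), x ∈ Set.Icc (fun _ : Fin n => a) (fun _ => b) :=
    (mem_ae_iff_prob_eq_one measurableSet_Icc).2 h1
  have h3 := hf.continuousOn.integrableOn_compact (μ := Measure.pi μ)
    (isCompact_Icc (a := fun _ : Fin n => a) (b := fun _ => b))
  rwa [IntegrableOn, Measure.restrict_eq_self_of_ae_mem h2] at h3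

lemma aux_integrable_one (a b : ℝ) (μ : Measure ℝ) [IsProbabilityMeasure μ]
    (hsupp : μ (Set.Icc a b) = 1) (f : ℝ → ℝ) (hf : Continuous f) :
    Integrable f μ := by
  have h2 : ∀ᵐ x ∂μ, x ∈ Set.Icc a b :=
    (mem_ae_iff_prob_eq_one measurableSet_Icc).2 hsupp
  have h3 := hf.continuousOn.integrableOn_compact (μ := μ) (isCompact_Icc (a := a) (b := b))
  rwa [IntegrableOn, Measure.restrict_eq_self_of_ae_mem h2] at h3

lemma aux_cont {E : Type*} [NormedAddCommGroup E] [NormedSpace ℝ E] [FiniteDimensional ℝ E]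
    (f : E → ℝ) (hf : ConvexOn ℝ Set.univ f) : Continuous f :=
  continuousOn_univ.1 (hf.continuousOn isOpen_univ)

lemma one_dim (a b : ℝ) (hab : a < b) (μ : Measure ℝ) [IsProbabilityMeasure μ]
    (hsupp : μ (Set.Icc a b) = 1) (f : ℝ → ℝ) (hf : ConvexOn ℝ Set.univ f)
    (h : ℝ → ℝ≥0∞)
    (hh : ∀ x ∈ Set.Icc a b, ∀ y ∈ Set.Icc a b,
      h x ≤ ENNReal.ofReal (Real.exp (f y + (x - y) ^ 2 / (2 * (b - a) ^ 2)))) :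
    ∫⁻ x, h x ∂μ ≤ ENNReal.ofReal (Real.exp (∫ x, f x ∂μ)) := by
  have hc := aux_cont f hf
  have hi := aux_integrable_one a b μ hsupp f hc
  have hae : ∀ᵐ x ∂μ, x ∈ Set.Icc a b :=
    (mem_ae_iff_prob_eq_one measurableSet_Icc).2 hsupp
  obtain ⟨z, hz, hmin⟩ := isCompact_Icc.exists_isMinOn (Set.nonempty_Icc.2 hab.le) hc.continuousOn
  have hmin' : ∀ x ∈ Set.Icc a b, f z ≤ f x := fun x hx => hmin hx
  have hD : 0 < (b - a) ^ 2 := by have := sub_pos.2 hab; positivity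
  have key : ∀ x ∈ Set.Icc a b,
      h x ≤ ENNReal.ofReal (Real.exp (f z) * (1 + (f x - f z))) := by
    intro x hx
    obtain ⟨θ, h0, h1, hθ⟩ := aux_exp (f x - f z) (sub_nonneg.2 (hmin' x hx))
    have hy : (1 - θ) * x + θ * z ∈ Set.Icc a b := by
      have := (convex_Icc a b) hx hz (sub_nonneg.2 h1) h0 (by ring)
      simpa using this
    refine (hh x hx _ hy).trans (ENNReal.ofReal_le_ofReal ?_)
    have hfy : f ((1 - θ) * x + θ * z) ≤ (1 - θ) * f x + θ * f z := by
      have := hf.2 (Set.mem_univ x) (Set.mem_univ z) (sub_nonneg.2 h1) h0 (by ring)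
      simpa using this
    have hcst : (x - ((1 - θ) * x + θ * z)) ^ 2 / (2 * (b - a) ^ 2) ≤ θ ^ 2 / 2 := by
      rw [div_le_div_iff₀ (by positivity) (by norm_num)]
      have e : x - ((1 - θ) * x + θ * z) = θ * (x - z) := by ring
      have hs : (x - z) ^ 2 ≤ (b - a) ^ 2 := by
        apply sq_le_sq'
        · linarith [hx.1, hz.2]
        · linarith [hx.2, hz.1]
      rw [e, mul_pow]
      nlinarith [mul_le_mul_of_nonneg_left hs (sq_nonneg θ)]
    calc _ ≤ Real.exp (f z + ((1 - θ) * (f x - f z) + θ ^ 2 / 2)) := by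
          apply Real.exp_le_exp.2; linarith
      _ ≤ _ := by
          rw [Real.exp_add]
          exact mul_le_mul_of_nonneg_left hθ (Real.exp_pos _).le
  have hi2 : Integrable (fun x => Real.exp (f z) * (1 + (f x - f z))) μ :=
    ((integrable_const _).add (hi.sub (integrable_const _))).const_mul _
  calc ∫⁻ x, h x ∂μ ≤ ∫⁻ x, ENNReal.ofReal (Real.exp (f z) * (1 + (f x - f z))) ∂μ :=
        lintegral_mono_ae (hae.mono key)
    _ = ENNReal.ofReal (∫ x, Real.exp (f z) * (1 + (f x - f z)) ∂μ) := by
        rw [ofReal_integral_eq_lintegral_ofReal hi2]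
        filter_upwards [hae] with x hx
        have := hmin' x hx
        exact mul_nonneg (Real.exp_pos _).le (by linarith)
    _ ≤ _ := by
        apply ENNReal.ofReal_le_ofReal
        rw [integral_const_mul, integral_add (g := fun x => f x - f z) (integrable_const _) (hi.sub (integrable_const _)),
          integral_sub hi (integrable_const _)]
        simp only [integral_const, probReal_univ, one_smul]
        calc _ ≤ Real.exp (f z) * Real.exp (∫ x, f x ∂μ - f z) :=
              mul_le_mul_of_nonneg_left (by linarith [Real.add_one_le_exp (∫ x, f x ∂μ - f z)])
                (Real.exp_pos _).le
          _ = _ := by rw [← Real.exp_add]; congr 1; ring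

lemma multi_dim (a b : ℝ) (hab : a < b) (n : ℕ) :
    ∀ (μ : Fin n → Measure ℝ) [∀ i, IsProbabilityMeasure (μ i)]
    (_ : ∀ i, μ i (Set.Icc a b) = 1) (f : (Fin n → ℝ) → ℝ) (_ : ConvexOn ℝ Set.univ f)
    (h : (Fin n → ℝ) → ℝ≥0∞) (_ : Measurable h)
    (_ : ∀ x y, h x ≤ ENNReal.ofReal
      (Real.exp (f y + ∑ i, (x i - y i) ^ 2 / (2 * (b - a) ^ 2)))),
    ∫⁻ x, h x ∂(Measure.pi μ) ≤ ENNReal.ofReal (Real.exp (∫ x, f x ∂(Measure.pi μ))) := by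
  induction n with
  | zero =>
    intro μ _ hs f hf h hm hh
    rw [Measure.pi_of_empty]
    simpa [integral_dirac, lintegral_dirac] using hh isEmptyElim isEmptyElim
  | succ n ih =>
    intro μ _ hs f hf h hm hh
    have hc := aux_cont f hf
    have mp := (measurePreserving_piFinSuccAbove μ 0).symm
    set e := (MeasurableEquiv.piFinSuccAbove (fun _ : Fin (n+1) => ℝ) 0).symm with he
    have hev : ∀ p : ℝ × (Fin n → ℝ), e p = Fin.cons p.1 p.2 := by
      intro p
      simp [he, MeasurableEquiv.piFinSuccAbove]
      rfl
    set ν := Measure.pi (fun j : Fin n => μ (Fin.succAbove 0 j)) with hν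
    have hi : Integrable (fun p => f (e p)) ((μ 0).prod ν) :=
      (mp.integrable_comp_emb e.measurableEmbedding).2 (aux_integrable a b μ hs f hc)
    have hI : ∫ x, f x ∂(Measure.pi μ) = ∫ x, ∫ y, f (Fin.cons x y) ∂ν ∂(μ 0) := by
      rw [← mp.integral_comp e.measurableEmbedding, integral_prod _ hi]
      simp [hev]
    have hJ : ∫⁻ x, h x ∂(Measure.pi μ) = ∫⁻ x, ∫⁻ y, h (Fin.cons x y) ∂ν ∂(μ 0) := by
      rw [← mp.lintegral_comp hm, lintegral_prod (fun p => h (e p)) (hm.comp e.measurable).aemeasurable]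
      simp [hev]
    have hcons : ∀ (s t : ℝ) (x₁ y₁ : ℝ) (x y : Fin n → ℝ),
        (Fin.cons (s * x₁ + t * y₁) (s • x + t • y) : Fin (n+1) → ℝ)
          = s • (Fin.cons x₁ x : Fin (n+1) → ℝ) + t • (Fin.cons y₁ y : Fin (n+1) → ℝ) := by
      intro s t x₁ y₁ x y
      ext i
      refine Fin.cases ?_ (fun j => ?_) i <;> simp
    have hfx : ∀ x₁ : ℝ, ConvexOn ℝ Set.univ (fun y : Fin n → ℝ => f (Fin.cons x₁ y)) := by
      intro x₁
      refine ⟨convex_univ, fun x _ y _ s t hs ht hst => ?_⟩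
      have := hf.2 (Set.mem_univ (Fin.cons x₁ x : Fin (n+1) → ℝ))
        (Set.mem_univ (Fin.cons x₁ y : Fin (n+1) → ℝ)) hs ht hst
      rw [← hcons, ← add_mul, hst, one_mul] at this
      exact this
    have hix : ∀ x₁ : ℝ, Integrable (fun y : Fin n → ℝ => f (Fin.cons x₁ y)) ν := fun x₁ =>
      aux_integrable a b _ (fun j => hs _) _ (aux_cont _ (hfx x₁))
    rw [hI, hJ]
    refine one_dim a b hab (μ 0) (hs 0) _ ?_ _ ?_
    · refine ⟨convex_univ, fun x _ y _ s t hs ht hst => ?_⟩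
      simp only [smul_eq_mul]
      rw [← integral_const_mul, ← integral_const_mul,
        ← integral_add ((hix x).const_mul s) ((hix y).const_mul t)]
      refine integral_mono (hix _) (((hix x).const_mul s).add ((hix y).const_mul t)) ?_
      intro w
      have := hf.2 (Set.mem_univ (Fin.cons x w : Fin (n+1) → ℝ))
        (Set.mem_univ (Fin.cons y w : Fin (n+1) → ℝ)) hs ht hst
      rw [← hcons, ← add_smul, hst, one_smul] at this
      exact this
    · intro x₁ _ y₁ _
      set c := (x₁ - y₁) ^ 2 / (2 * (b - a) ^ 2) with hcdef
      have := ih (fun j : Fin n => μ (Fin.succAbove 0 j)) (fun j => hs _)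
        (fun y => f (Fin.cons y₁ y) + c) ((hfx y₁).add_const c)
        (fun x => h (Fin.cons x₁ x)) ?_ ?_
      · refine this.trans (le_of_eq ?_)
        rw [← hν, integral_add (hix y₁) (integrable_const _)]
        simp
      · have : (fun x => h (Fin.cons x₁ x)) = fun x => h (e (x₁, x)) := by
          ext x; rw [hev]
        rw [this]
        exact hm.comp (e.measurable.comp measurable_prodMk_left)
      · intro x y
        refine (hh (Fin.cons x₁ x) (Fin.cons y₁ y)).trans (le_of_eq ?_)
        rw [Fin.sum_univ_succ]
        simp [hcdef, add_assoc]

lemma lq_fin (q : ℝ≥0∞) {L : ℕ} (v : Fin L → ℝ) : eLpNorm v q Measure.count ≠ ∞ :=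
  (MemLp.of_discrete (f := v) (p := q) (μ := Measure.count)).2.ne

lemma lq_add (q : ℝ≥0∞) (hq : 1 ≤ q) {L : ℕ} (v w : Fin L → ℝ) :
    lqNorm q (v + w) ≤ lqNorm q v + lqNorm q w := by
  unfold lqNorm
  rw [← ENNReal.toReal_add (lq_fin q v) (lq_fin q w)]
  exact ENNReal.toReal_mono (ENNReal.add_ne_top.2 ⟨lq_fin q v, lq_fin q w⟩)
    (eLpNorm_add_le (by fun_prop) (by fun_prop) hq)

lemma lq_smul (q : ℝ≥0∞) {L : ℕ} (c : ℝ) (v : Fin L → ℝ) :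
    lqNorm q (c • v) = |c| * lqNorm q v := by
  unfold lqNorm
  rw [eLpNorm_const_smul, ENNReal.toReal_mul]
  simp

lemma lq_mono (q : ℝ≥0∞) {L : ℕ} (v w : Fin L → ℝ) (h : ∀ j, |v j| ≤ w j) :
    lqNorm q v ≤ lqNorm q w :=
  ENNReal.toReal_mono (lq_fin q w) (eLpNorm_mono_real h)

/-- Lemma 4.2: concentration for independent bounded noise. -/
theorem bounded_concentration_lqNorm
    (n L : ℕ) (hn : 1 ≤ n) (hL : 1 ≤ L) (X : Fin n → Fin L → ℝ)
    (a b : ℝ) (hab : a < b)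
    (μ : Fin n → Measure ℝ) [∀ i, IsProbabilityMeasure (μ i)]
    (hsupp : ∀ i, μ i (Set.Icc a b) = 1)
    (q : ℝ≥0∞) (hq : 1 ≤ q) (t : ℝ) (ht : 0 ≤ t) :
    ((Measure.pi μ) {w : Fin n → ℝ |
        lqNorm q (fun j => (1 / (n : ℝ)) * ∑ i, X i j * w i)
          ≥ (∫ w', lqNorm q (fun j => (1 / (n : ℝ)) * ∑ i, X i j * w' i)
              ∂(Measure.pi μ)) + t}).toReal
      ≤ Real.exp (-(n * t ^ 2) / (2 * (b - a) ^ 2 * (Nq q X) ^ 2)) := by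
  have hN0 : 0 ≤ Nq q X := ENNReal.toReal_nonneg
  have hn0 : (0 : ℝ) < n := by exact_mod_cast hn
  have hD0 : 0 < b - a := sub_pos.2 hab
  rcases hN0.eq_or_lt with hN | hN
  · rw [← hN]
    refine (measureReal_le_one (μ := Measure.pi μ)).trans (le_of_eq ?_)
    simp
  set N := Nq q X with hNdef
  set A : (Fin n → ℝ) → (Fin L → ℝ) := fun w j => (1 / (n : ℝ)) * ∑ i, X i j * w i with hA
  set p : (Fin n → ℝ) → ℝ := fun w => lqNorm q (A w) with hp
  change ((Measure.pi μ) {w | p w ≥ (∫ w', p w' ∂(Measure.pi μ)) + t}).toReal ≤ _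
  have hAlin : ∀ (s r : ℝ) (x y : Fin n → ℝ), A (s • x + r • y) = s • A x + r • A y := by
    intro s r x y
    ext j
    simp only [hA, Pi.add_apply, Pi.smul_apply, smul_eq_mul, Finset.mul_sum,
      ← Finset.sum_add_distrib]
    exact Finset.sum_congr rfl fun i _ => by ring
  have hconv : ConvexOn ℝ Set.univ p := by
    refine ⟨convex_univ, fun x _ y _ s r hs hr _ => ?_⟩
    simp only [hp, hAlin, smul_eq_mul]
    refine (lq_add q hq _ _).trans (le_of_eq ?_)
    rw [lq_smul, lq_smul, abs_of_nonneg hs, abs_of_nonneg hr]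
  have hcont := aux_cont p hconv
  have hlip : ∀ v : Fin n → ℝ, p v ≤ Real.sqrt ((∑ i, v i ^ 2) / n) * N := by
    intro v
    rw [hNdef, Nq, ← abs_of_nonneg (Real.sqrt_nonneg ((∑ i, v i ^ 2) / n)), ← lq_smul]
    refine lq_mono q _ _ fun j => ?_
    simp only [hA, Pi.smul_apply, smul_eq_mul]
    rw [← Real.sqrt_mul (by positivity)]
    apply Real.abs_le_sqrt
    have := Finset.sum_mul_sq_le_sq_mul_sq Finset.univ (fun i => X i j) v
    rw [mul_pow]
    calc _ ≤ (1 / (n : ℝ)) ^ 2 * ((∑ i, X i j ^ 2) * ∑ i, v i ^ 2) :=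
          mul_le_mul_of_nonneg_left this (by positivity)
      _ = _ := by ring
  have hsub : ∀ x y, p x ≤ p y + p (x - y) := by
    intro x y
    have e : A x = A y + A (x - y) := by
      have := hAlin 1 1 y (x - y)
      simpa using this
    simp only [hp]
    rw [e]
    exact lq_add q hq _ _
  set V := (b - a) ^ 2 * N ^ 2 / n with hV
  have hVpos : 0 < V := by positivity
  set lam := t / V with hlam
  have hlam0 : 0 ≤ lam := by positivity
  set m := ∫ w', p w' ∂(Measure.pi μ) with hm
  have hmain := multi_dim a b hab n μ hsupp (fun w => lam * p w)
    (hconv.smul hlam0) (fun w => ENNReal.ofReal (Real.exp (lam * p w - lam ^ 2 * V / 2)))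
    (by have := hcont.measurable; fun_prop) (by
      intro x y
      apply ENNReal.ofReal_le_ofReal
      apply Real.exp_le_exp.2
      have h1 := hsub x y
      have h2 := hlip (x - y)
      simp only [Pi.sub_apply] at h2
      rw [← Finset.sum_div]
      set S := ∑ i, (x i - y i) ^ 2 with hS
      have hS0 : 0 ≤ S := Finset.sum_nonneg fun i _ => sq_nonneg _
      have h3 : lam * p x ≤ lam * p y + lam * (Real.sqrt (S / n) * N) := by
        rw [← mul_add]; exact mul_le_mul_of_nonneg_left (by linarith) hlam0
      set r := Real.sqrt (S / n) with hr
      have hr2 : r ^ 2 = S / n := Real.sq_sqrt (by positivity)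
      have hSr : S = n * r ^ 2 := by rw [hr2]; field_simp
      have h4 : lam * (r * N) ≤ S / (2 * (b - a) ^ 2) + lam ^ 2 * V / 2 := by
        have : S / (2 * (b - a) ^ 2) + lam ^ 2 * V / 2 - lam * (r * N)
            = (n * r - lam * (b - a) ^ 2 * N) ^ 2 / (2 * n * (b - a) ^ 2) := by
          rw [hSr, hV]; field_simp; ring
        have h5 : 0 ≤ (n * r - lam * (b - a) ^ 2 * N) ^ 2 / (2 * n * (b - a) ^ 2) := by
          positivity
        linarith
      linarith)
  rw [integral_const_mul, ← hm] at hmain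
  have hcheb := mul_meas_ge_le_lintegral (μ := Measure.pi μ)
    (f := fun w => ENNReal.ofReal (Real.exp (lam * p w - lam ^ 2 * V / 2)))
    (by have := hcont.measurable; fun_prop)
    (ENNReal.ofReal (Real.exp (lam * (m + t) - lam ^ 2 * V / 2)))
  have hset : (Measure.pi μ) {w | p w ≥ m + t} ≤ (Measure.pi μ)
      {w | ENNReal.ofReal (Real.exp (lam * (m + t) - lam ^ 2 * V / 2)) ≤
        ENNReal.ofReal (Real.exp (lam * p w - lam ^ 2 * V / 2))} := by
    apply measure_mono
    intro w hw
    apply ENNReal.ofReal_le_ofReal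
    apply Real.exp_le_exp.2
    have := mul_le_mul_of_nonneg_left hw hlam0
    linarith
  have hfin := (mul_le_mul_right hset _).trans (hcheb.trans hmain)
  have hreal := ENNReal.toReal_mono ENNReal.ofReal_ne_top hfin
  rw [ENNReal.toReal_mul, ENNReal.toReal_ofReal (Real.exp_pos _).le,
    ENNReal.toReal_ofReal (Real.exp_pos _).le, mul_comm, ← le_div_iff₀ (Real.exp_pos _),
    ← Real.exp_sub] at hreal
  refine hreal.trans (le_of_eq ?_)
  congr 1
  rw [hlam, hV]
  field_simp
  ring
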